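/- arXiv:1306.2812 — 9 statements merged into one kernel-verified Lean document; each statement's English description precedes it below -/
import Mathlib

section
/- Theorem 1(ii) (fixed-φ likelihood is proportional to the likelihood ignoring the missingness mechanism): Suppose the data are realised MAR and the joint parameter space is rectangular, Ω = Ω_θ × Ω_φ. Then for any φ ∈ Ω_φ satisfying g φ m̃ ỹ > 0, there exists a constant c > 0 (namely c = g φ m̃ ỹ) such that for every θ ∈ Ω_θ, L₃,φ(θ) = c · L₂(θ). -/
open Classical

/-- Theorem 1(ii): under realised MAR and a rectangular joint parameter space,
for any `φ ∈ Ω_φ` with `g φ mr yr > 0`, the fixed-`φ` likelihood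
`L₃,φ(θ) = δ{(θ,φ) ∈ Ω} · L₁(θ,φ)` equals `c · L₂(θ)` on `Ω_θ`
for the strictly positive constant `c = g φ mr yr`. -/
theorem fixedPhi_likelihood_propto_L2_of_realisedMAR
    {ι : Type*} [Fintype ι] [DecidableEq ι]
    {V : ι → Type*} [∀ i, Fintype (V i)] [∀ i, DecidableEq (V i)]
    {Θ Φ : Type*}
    (Ω : Set (Θ × Φ))
    (f : Θ → ((i : ι) → V i) → ℝ)
    (g : Φ → (ι → Bool) → ((i : ι) → V i) → ℝ)
    (hf : ∀ θ y, 0 ≤ f θ y)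
    (hg : ∀ φ m y, 0 ≤ g φ m y)
    (mr : ι → Bool) (yr : (i : ι) → V i)
    (hrect : Ω = {θ : Θ | ∃ φ, (θ, φ) ∈ Ω} ×ˢ {φ : Φ | ∃ θ, (θ, φ) ∈ Ω})
    (hMAR : ∀ φ ∈ {φ : Φ | ∃ θ, (θ, φ) ∈ Ω}, ∀ y : (i : ι) → V i,
      (∀ i, mr i = true → y i = yr i) → g φ mr y = g φ mr yr) :
    ∀ φ ∈ {φ : Φ | ∃ θ, (θ, φ) ∈ Ω}, 0 < g φ mr yr →
      ∃ c : ℝ, 0 < c ∧ c = g φ mr yr ∧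
        ∀ θ ∈ {θ : Θ | ∃ φ, (θ, φ) ∈ Ω},
          (if (θ, φ) ∈ Ω then (1 : ℝ) else 0) *
            (∑ y ∈ Finset.univ.filter (fun y : (i : ι) → V i => ∀ i, mr i = true → y i = yr i),
              f θ y * g φ mr y)
          = c * ∑ y ∈ Finset.univ.filter (fun y : (i : ι) → V i => ∀ i, mr i = true → y i = yr i), f θ y := by
  intro φ hφ hpos
  refine ⟨g φ mr yr, hpos, rfl, fun θ hθ => ?_⟩
  have hmem : (θ, φ) ∈ Ω := by
    rw [hrect]
    exact ⟨hθ, hφ⟩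
  rw [if_pos hmem, one_mul, Finset.mul_sum]
  refine Finset.sum_congr rfl fun y hy => ?_
  rw [hMAR φ hφ y (Finset.mem_filter.mp hy).2, mul_comm]
end

section
/- Theorem 1(iii) (profile likelihood is proportional to the likelihood ignoring the missingness mechanism): Suppose the data are realised MAR, the joint parameter space is rectangular Ω = Ω_θ × Ω_φ, Ω_φ is nonempty, and the set {g φ m̃ ỹ | φ ∈ Ω_φ} is bounded above. Let S = sup_{φ ∈ Ω_φ} g φ m̃ ỹ. Then for every θ ∈ Ω_θ, L₄(θ) = S · L₂(θ); moreover, if there exists φ ∈ Ω_φ with g φ m̃ ỹ > 0, then S > 0, so L₄ is proportional to L₂ on Ω_θ with a strictly positive constant of proportionality. -/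
open Classical

/-- Theorem 1(iii): under realised MAR and a rectangular joint parameter space,
with `Ω_φ` nonempty and `{g φ mr yr | φ ∈ Ω_φ}` bounded above, the profile
likelihood `L₄(θ) = sup_{φ ∈ Ω_φ} L₃,φ(θ)` satisfies `L₄(θ) = S · L₂(θ)`
for `S = sup_{φ ∈ Ω_φ} g φ mr yr`; and if some `φ ∈ Ω_φ` has `g φ mr yr > 0`
then `S > 0`. -/
theorem profile_likelihood_propto_L2_of_realisedMAR
    {ι : Type*} [Fintype ι] [DecidableEq ι]
    {V : ι → Type*} [∀ i, Fintype (V i)] [∀ i, DecidableEq (V i)]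
    {Θ Φ : Type*}
    (Ω : Set (Θ × Φ))
    (f : Θ → ((i : ι) → V i) → ℝ)
    (g : Φ → (ι → Bool) → ((i : ι) → V i) → ℝ)
    (hf : ∀ θ y, 0 ≤ f θ y)
    (hg : ∀ φ m y, 0 ≤ g φ m y)
    (mr : ι → Bool) (yr : (i : ι) → V i)
    (hrect : Ω = {θ : Θ | ∃ φ, (θ, φ) ∈ Ω} ×ˢ {φ : Φ | ∃ θ, (θ, φ) ∈ Ω})
    (hMAR : ∀ φ ∈ {φ : Φ | ∃ θ, (θ, φ) ∈ Ω}, ∀ y : (i : ι) → V i,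
      (∀ i, mr i = true → y i = yr i) → g φ mr y = g φ mr yr)
    (hne : {φ : Φ | ∃ θ, (θ, φ) ∈ Ω}.Nonempty)
    (hbdd : BddAbove {r : ℝ | ∃ φ ∈ {φ : Φ | ∃ θ, (θ, φ) ∈ Ω}, r = g φ mr yr}) :
    (∀ θ ∈ {θ : Θ | ∃ φ, (θ, φ) ∈ Ω},
      sSup {r : ℝ | ∃ φ ∈ {φ : Φ | ∃ θ, (θ, φ) ∈ Ω},
          r = (if (θ, φ) ∈ Ω then (1 : ℝ) else 0) *
            ∑ y ∈ Finset.univ.filter (fun y : (i : ι) → V i => ∀ i, mr i = true → y i = yr i),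
              f θ y * g φ mr y}
      = sSup {r : ℝ | ∃ φ ∈ {φ : Φ | ∃ θ, (θ, φ) ∈ Ω}, r = g φ mr yr} *
        ∑ y ∈ Finset.univ.filter (fun y : (i : ι) → V i => ∀ i, mr i = true → y i = yr i), f θ y)
    ∧ ((∃ φ ∈ {φ : Φ | ∃ θ, (θ, φ) ∈ Ω}, 0 < g φ mr yr) →
        0 < sSup {r : ℝ | ∃ φ ∈ {φ : Φ | ∃ θ, (θ, φ) ∈ Ω}, r = g φ mr yr}) := by
  refine ⟨fun θ hθ => ?_, ?_⟩
  · rw [mul_comm, ← smul_eq_mul,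
      ← Real.sSup_smul_of_nonneg (Finset.sum_nonneg fun y _ => hf θ y)]
    congr 1
    have fixed_eq : ∀ φ ∈ {φ : Φ | ∃ θ, (θ, φ) ∈ Ω},
        (if (θ, φ) ∈ Ω then (1 : ℝ) else 0) *
          ∑ y ∈ Finset.univ.filter (fun y : (i : ι) → V i => ∀ i, mr i = true → y i = yr i),
            f θ y * g φ mr y =
        (∑ y ∈ Finset.univ.filter (fun y : (i : ι) → V i => ∀ i, mr i = true → y i = yr i),
          f θ y) * g φ mr yr := by
      intro φ hφ
      have hmem : (θ, φ) ∈ Ω := by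
        rw [hrect]
        exact ⟨hθ, hφ⟩
      rw [if_pos hmem, one_mul, Finset.sum_mul]
      refine Finset.sum_congr rfl fun y hy => ?_
      rw [hMAR φ hφ y (Finset.mem_filter.mp hy).2]
    ext r
    rw [Set.mem_smul_set]
    constructor
    · rintro ⟨φ, hφ, rfl⟩
      exact ⟨g φ mr yr, ⟨φ, hφ, rfl⟩, (fixed_eq φ hφ).symm⟩
    · rintro ⟨_, ⟨φ, hφ, rfl⟩, rfl⟩
      exact ⟨φ, hφ, (fixed_eq φ hφ).symm⟩
  · rintro ⟨φ, hφ, hpos⟩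
    exact hpos.trans_le (le_csSup hbdd ⟨φ, hφ, rfl⟩)
end

section
/- Theorem 2 (ignorability for Bayesian inference): Suppose Θ and Φ are finite types, the data are realised MAR (with Ω_φ all of Φ), and the prior p : Θ × Φ → ℝ is nonnegative and factorises as p(θ,φ) = p_θ(θ) · p_φ(φ) with p_θ, p_φ nonnegative (a priori independence of θ and φ). Let Z = ∑_{(θ,φ)} p(θ,φ) · L₁(θ,φ) and Z₂ = ∑_θ p_θ(θ) · L₂(θ), and suppose Z > 0. Then Z₂ > 0, and for every θ, the marginal posterior of θ from the joint model equals the posterior from the model ignoring the missingness mechanism: (∑_φ p(θ,φ) · L₁(θ,φ)) / Z = p_θ(θ) · L₂(θ) / Z₂. -/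
/-- Theorem 2 (ignorability for Bayesian inference): under realised MAR and
a-priori independence of `θ` and `φ`, the marginal posterior for `θ` from the
joint model equals the posterior from the model ignoring the missingness
mechanism. -/
theorem bayesian_ignorability_of_realisedMAR
    {ι : Type*} [Fintype ι] [DecidableEq ι]
    {V : ι → Type*} [∀ i, Fintype (V i)] [∀ i, DecidableEq (V i)]
    {Θ Φ : Type*} [Fintype Θ] [Fintype Φ]
    (f : Θ → ((i : ι) → V i) → ℝ)
    (g : Φ → (ι → Bool) → ((i : ι) → V i) → ℝ)
    (hf : ∀ θ y, 0 ≤ f θ y)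
    (hg : ∀ φ m y, 0 ≤ g φ m y)
    (mr : ι → Bool) (yr : (i : ι) → V i)
    -- realised MAR (with Ω_φ = Φ)
    (hMAR : ∀ φ : Φ, ∀ y : (i : ι) → V i,
      (∀ i, mr i = true → y i = yr i) → g φ mr y = g φ mr yr)
    (p : Θ × Φ → ℝ) (pθ : Θ → ℝ) (pφ : Φ → ℝ)
    (hp : ∀ x, 0 ≤ p x) (hpθ : ∀ θ, 0 ≤ pθ θ) (hpφ : ∀ φ, 0 ≤ pφ φ)
    -- a priori independence: the prior factorises
    (hfact : ∀ θ φ, p (θ, φ) = pθ θ * pφ φ)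
    -- Z > 0
    (hZ : 0 < ∑ x : Θ × Φ, p x *
        ∑ y ∈ Finset.univ.filter (fun y : (i : ι) → V i => ∀ i, mr i = true → y i = yr i),
          f x.1 y * g x.2 mr y) :
    0 < (∑ θ : Θ, pθ θ * ∑ y ∈ Finset.univ.filter (fun y : (i : ι) → V i => ∀ i, mr i = true → y i = yr i), f θ y) ∧
    ∀ θ : Θ,
      (∑ φ : Φ, p (θ, φ) *
          ∑ y ∈ Finset.univ.filter (fun y : (i : ι) → V i => ∀ i, mr i = true → y i = yr i),
            f θ y * g φ mr y) /
        (∑ x : Θ × Φ, p x *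
          ∑ y ∈ Finset.univ.filter (fun y : (i : ι) → V i => ∀ i, mr i = true → y i = yr i),
            f x.1 y * g x.2 mr y)
      = pθ θ * (∑ y ∈ Finset.univ.filter (fun y : (i : ι) → V i => ∀ i, mr i = true → y i = yr i), f θ y) /
          (∑ θ' : Θ, pθ θ' * ∑ y ∈ Finset.univ.filter (fun y : (i : ι) → V i => ∀ i, mr i = true → y i = yr i), f θ' y) := by
  set S := Finset.univ.filter (fun y : (i : ι) → V i => ∀ i, mr i = true → y i = yr i) with hS
  have hL : ∀ θ φ, ∑ y ∈ S, f θ y * g φ mr y = (∑ y ∈ S, f θ y) * g φ mr yr := by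
    intro θ φ
    rw [Finset.sum_mul]
    refine Finset.sum_congr rfl fun y hy => ?_
    rw [hMAR φ y (by simpa [hS] using hy)]
  have hmarg : ∀ θ, ∑ φ, p (θ, φ) * ∑ y ∈ S, f θ y * g φ mr y
      = (pθ θ * ∑ y ∈ S, f θ y) * ∑ φ, pφ φ * g φ mr yr := by
    intro θ
    rw [Finset.mul_sum]
    refine Finset.sum_congr rfl fun φ _ => ?_
    rw [hL, hfact]
    ring
  have hZ_eq : ∑ x : Θ × Φ, p x * ∑ y ∈ S, f x.1 y * g x.2 mr y
      = (∑ θ, pθ θ * ∑ y ∈ S, f θ y) * ∑ φ, pφ φ * g φ mr yr := by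
    rw [Fintype.sum_prod_type, Finset.sum_mul]
    exact Finset.sum_congr rfl fun θ _ => hmarg θ
  have hC : 0 ≤ ∑ φ, pφ φ * g φ mr yr :=
    Finset.sum_nonneg fun φ _ => mul_nonneg (hpφ φ) (hg φ mr yr)
  rw [hZ_eq] at hZ ⊢
  refine ⟨pos_of_mul_pos_left hZ hC, fun θ => ?_⟩
  rw [hmarg, mul_div_mul_right _ _ (right_ne_zero_of_mul hZ.ne')]
end

section
/- Appendix Theorem (realised MAR is necessary and sufficient for ignorability under completeness): Suppose the joint parameter space is rectangular, Ω = Ω_θ × Ω_φ; that g φ m̃ ỹ > 0 for every φ ∈ Ω_φ; that L₂(θ) > 0 for every θ ∈ Ω_θ; and that the family of conditional distributions f₂,θ(y) = f θ y / L₂(θ) (defined for y with o(y,m̃)=o(ỹ,m̃)) is complete, meaning: for every function h : ((i : ι) → V i) → ℝ, if ∑_{y : o(y,m̃)=o(ỹ,m̃)} f₂,θ(y) · h(y) = 0 for every θ ∈ Ω_θ, then h(y) = 0 for every y with o(y,m̃)=o(ỹ,m̃). Then L₁(·,φ) is proportional to L₂ on Ω_θ for every φ ∈ Ω_φ (i.e.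 for every φ ∈ Ω_φ there exists a constant c with L₁(θ,φ) = c · L₂(θ) for all θ ∈ Ω_θ) if and only if the data are realised MAR. -/
/-- Appendix Theorem: if the joint parameter space is rectangular,
`g φ mr yr > 0` on `Ω_φ`, `L₂ > 0` on `Ω_θ`, and the family of conditional
distributions `f₂,θ(y) = f θ y / L₂(θ)` is complete, then `L₁(·,φ)` is
proportional to `L₂` on `Ω_θ` for every `φ ∈ Ω_φ` iff the data are realised
MAR. -/
theorem realisedMAR_iff_ignorable_of_complete
    {ι : Type*} [Fintype ι] [DecidableEq ι]
    {V : ι → Type*} [∀ i, Fintype (V i)] [∀ i, DecidableEq (V i)]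
    {Θ Φ : Type*}
    (Ω : Set (Θ × Φ))
    (f : Θ → ((i : ι) → V i) → ℝ)
    (g : Φ → (ι → Bool) → ((i : ι) → V i) → ℝ)
    (hf : ∀ θ y, 0 ≤ f θ y)
    (hg : ∀ φ m y, 0 ≤ g φ m y)
    (mr : ι → Bool) (yr : (i : ι) → V i)
    (hrect : Ω = {θ : Θ | ∃ φ, (θ, φ) ∈ Ω} ×ˢ {φ : Φ | ∃ θ, (θ, φ) ∈ Ω})
    (hgpos : ∀ φ ∈ {φ : Φ | ∃ θ, (θ, φ) ∈ Ω}, 0 < g φ mr yr)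
    (hL2pos : ∀ θ ∈ {θ : Θ | ∃ φ, (θ, φ) ∈ Ω},
      0 < ∑ y ∈ Finset.univ.filter (fun y : (i : ι) → V i => ∀ i, mr i = true → y i = yr i), f θ y)
    -- completeness of the family f₂,θ(y) = f θ y / L₂(θ)
    (hcomplete : ∀ h : ((i : ι) → V i) → ℝ,
      (∀ θ ∈ {θ : Θ | ∃ φ, (θ, φ) ∈ Ω},
        ∑ y ∈ Finset.univ.filter (fun y : (i : ι) → V i => ∀ i, mr i = true → y i = yr i),
          (f θ y / ∑ y' ∈ Finset.univ.filter (fun y : (i : ι) → V i => ∀ i, mr i = true → y i = yr i), f θ y') * h y = 0) →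
      ∀ y : (i : ι) → V i, (∀ i, mr i = true → y i = yr i) → h y = 0) :
    (∀ φ ∈ {φ : Φ | ∃ θ, (θ, φ) ∈ Ω}, ∃ c : ℝ,
      ∀ θ ∈ {θ : Θ | ∃ φ, (θ, φ) ∈ Ω},
        (∑ y ∈ Finset.univ.filter (fun y : (i : ι) → V i => ∀ i, mr i = true → y i = yr i), f θ y * g φ mr y)
        = c * ∑ y ∈ Finset.univ.filter (fun y : (i : ι) → V i => ∀ i, mr i = true → y i = yr i), f θ y)
    ↔ (∀ φ ∈ {φ : Φ | ∃ θ, (θ, φ) ∈ Ω}, ∀ y : (i : ι) → V i,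
        (∀ i, mr i = true → y i = yr i) → g φ mr y = g φ mr yr) := by
  constructor
  · intro hprop φ hφ y hy
    obtain ⟨c, hc⟩ := hprop φ hφ
    have hconst := hcomplete (fun y => g φ mr y - c) fun θ hθ => by
      simp only [div_mul_eq_mul_div, ← Finset.sum_div, mul_sub, Finset.sum_sub_distrib,
        ← Finset.sum_mul]
      rw [hc θ hθ, mul_comm c, sub_self]
    linarith [hconst y hy, hconst yr fun _ _ => rfl]
  · intro hmar φ hφ
    refine ⟨g φ mr yr, fun θ _ => ?_⟩
    rw [Finset.mul_sum]
    refine Finset.sum_congr rfl fun y hy => ?_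
    rw [hmar φ hφ y (Finset.mem_filter.mp hy).2, mul_comm]
end

section
/- Conditional version of Theorem 3 with covariate-dependent MCAR (Section 5): Let b : ((i : ι) → V i) → X be a function of the complete data, let x̃ = b(ỹ), and suppose the missingness model satisfies the weaker condition: for every φ ∈ Ω_φ and all y, y' with b(y) = b(y') = x̃, g φ m̃ y = g φ m̃ y'. Let θ ∈ Ω_θ and φ ∈ Ω_φ be such that ∑_{y : b(y) = x̃} f θ y · g φ m̃ y > 0. Then for every complete-data value y₀, (∑_{y : o(y,m̃)=o(y₀,m̃) ∧ b(y)=x̃} f θ y · g φ m̃ y) / (∑_{y : b(y)=x̃} f θ y · g φ m̃ y) = (∑_{y : o(y,m̃)=o(y₀,m̃) ∧ b(y)=x̃} f θ y) / (∑_{y : b(y)=x̃} f θ y); that is, conditional on M = m̃ and X = x̃, the correct conditional sampling distribution of the observed data equals the potentially incorrect one. -/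
/-- Conditional version of Theorem 3 under covariate-dependent MCAR: with
repeated sampling conditional on `M = mr` and `X = b(Y) = xr`, the correct
conditional sampling distribution of the observed data equals the potentially
incorrect one. -/
theorem conditional_correct_eq_potentiallyIncorrect_of_covariateMCAR
    {ι : Type*} [Fintype ι] [DecidableEq ι]
    {V : ι → Type*} [∀ i, Fintype (V i)] [∀ i, DecidableEq (V i)]
    {Θ Φ : Type*}
    (Ω : Set (Θ × Φ))
    (f : Θ → ((i : ι) → V i) → ℝ)
    (g : Φ → (ι → Bool) → ((i : ι) → V i) → ℝ)
    (hf : ∀ θ y, 0 ≤ f θ y)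
    (hg : ∀ φ m y, 0 ≤ g φ m y)
    (mr : ι → Bool) (yr : (i : ι) → V i)
    {X : Type*} [DecidableEq X]
    (b : ((i : ι) → V i) → X) (xr : X) (hxr : xr = b yr)
    -- the weaker, covariate-dependent MCAR condition
    (hcd : ∀ φ ∈ {φ : Φ | ∃ θ, (θ, φ) ∈ Ω}, ∀ y y' : (i : ι) → V i,
      b y = xr → b y' = xr → g φ mr y = g φ mr y')
    (θ : Θ) (φ : Φ)
    (hθ : θ ∈ {θ : Θ | ∃ φ, (θ, φ) ∈ Ω}) (hφ : φ ∈ {φ : Φ | ∃ θ, (θ, φ) ∈ Ω})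
    (hpos : 0 < ∑ y ∈ Finset.univ.filter (fun y : (i : ι) → V i => b y = xr),
      f θ y * g φ mr y) :
    ∀ y₀ : (i : ι) → V i,
      (∑ y ∈ Finset.univ.filter
          (fun y : (i : ι) → V i =>
            (∀ i, mr i = true → y i = y₀ i) ∧ b y = xr),
        f θ y * g φ mr y) /
        (∑ y ∈ Finset.univ.filter (fun y : (i : ι) → V i => b y = xr),
          f θ y * g φ mr y)
      = (∑ y ∈ Finset.univ.filter
          (fun y : (i : ι) → V i =>
            (∀ i, mr i = true → y i = y₀ i) ∧ b y = xr),
          f θ y) /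
        (∑ y ∈ Finset.univ.filter (fun y : (i : ι) → V i => b y = xr),
          f θ y) := by
  intro y₀
  have sum_mul_const : ∀ s : Finset ((i : ι) → V i), (∀ y ∈ s, b y = xr) →
      ∑ y ∈ s, f θ y * g φ mr y = (∑ y ∈ s, f θ y) * g φ mr yr := by
    intro s hs
    rw [Finset.sum_mul]
    exact Finset.sum_congr rfl fun y hy => by rw [hcd φ hφ y yr (hs y hy) hxr.symm]
  have hden := sum_mul_const (Finset.univ.filter fun y => b y = xr)
    fun y hy => (Finset.mem_filter.mp hy).2
  rw [hden] at hpos ⊢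
  rw [sum_mul_const _ fun y hy => (Finset.mem_filter.mp hy).2.2]
  exact mul_div_mul_right _ _ (right_ne_zero_of_mul hpos.ne')
end

section
/- Equivalence of Definitions 2 and 3 of everywhere MAR in the i.i.d. case: suppose n ≥ 1 and the joint missingness model factorises over units, g φ m y = ∏_{i : Fin n} g₁ φ (m i) (y i), where for every φ and every per-unit data value u, g₁ φ p u ≥ 0 and ∑_{p : J → Bool} g₁ φ p u = 1. Then the joint model is everywhere MAR (for every φ, every joint pattern m and all joint data y, y' satisfying y i j = y' i j whenever m i j = true, g φ m y = g φ m y') if and only if the per-unit model is everywhere MAR (for every φ, every per-unit pattern p and all per-unit data u, u' with o₁(u,p)=o₁(u',p), g₁ φ p u = g₁ φ p u'). -/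
/-- Equivalence of Definitions 2 and 3 of everywhere MAR in the i.i.d. case:
when the joint missingness model factorises over units as a product of
identical per-unit models, the joint model is everywhere MAR iff the per-unit
model is everywhere MAR. -/
theorem everywhereMAR_joint_iff_perUnit_iid
    {J : Type*} [Fintype J] [DecidableEq J]
    {W : J → Type*} [∀ j, Fintype (W j)] [∀ j, DecidableEq (W j)]
    {Φ : Type*}
    (n : ℕ) (hn : 1 ≤ n)
    (g₁ : Φ → (J → Bool) → ((j : J) → W j) → ℝ)
    (hg₁ : ∀ φ p u, 0 ≤ g₁ φ p u)
    (hnorm : ∀ φ (u : (j : J) → W j), ∑ p : J → Bool, g₁ φ p u = 1) :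
    -- joint model (g φ m y = ∏ i, g₁ φ (m i) (y i)) is everywhere MAR
    (∀ φ : Φ, ∀ m : Fin n → J → Bool,
      ∀ y y' : Fin n → (j : J) → W j,
      (∀ i j, m i j = true → y i j = y' i j) →
        ∏ i : Fin n, g₁ φ (m i) (y i) = ∏ i : Fin n, g₁ φ (m i) (y' i))
    ↔
    -- per-unit model is everywhere MAR
    (∀ φ : Φ, ∀ p : J → Bool, ∀ u u' : (j : J) → W j,
      (∀ j, p j = true → u j = u' j) → g₁ φ p u = g₁ φ p u') := by
  constructor
  · intro h φ p u u' huu'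
    have hpow : g₁ φ p u ^ n = g₁ φ p u' ^ n := by
      simpa using h φ (fun _ => p) (fun _ => u) (fun _ => u') (fun _ => huu')
    exact (pow_left_inj₀ (hg₁ φ p u) (hg₁ φ p u') (by omega)).mp hpow
  · intro h φ m y y' hyy'
    exact Finset.prod_congr rfl fun i _ => h φ (m i) (y i) (y' i) (hyy' i)
end

section
/- Maximum likelihood estimation ignoring the missingness mechanism (Section 5.4 claim): Suppose the data are realised MAR and the joint parameter space is rectangular, Ω = Ω_θ × Ω_φ. If (θ̂, φ̂) ∈ Ω maximises the joint likelihood over Ω (L₁(θ,φ) ≤ L₁(θ̂,φ̂) for all (θ,φ) ∈ Ω) and g φ̂ m̃ ỹ > 0, then θ̂ maximises L₂ over Ω_θ, i.e. L₂(θ) ≤ L₂(θ̂) for every θ ∈ Ω_θ. In other words, the MLE of θ is the same whether computed from the joint likelihood L₁ or from the likelihood L₂ ignoring the missingness mechanism. -/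
/-- Maximum likelihood estimation ignoring the missingness mechanism: under
realised MAR and a rectangular joint parameter space, if `(θh, φh) ∈ Ω`
maximises the joint likelihood `L₁` over `Ω` and `g φh mr yr > 0`, then `θh`
maximises `L₂` over `Ω_θ`. -/
theorem mle_ignoring_missingness_of_realisedMAR
    {ι : Type*} [Fintype ι] [DecidableEq ι]
    {V : ι → Type*} [∀ i, Fintype (V i)] [∀ i, DecidableEq (V i)]
    {Θ Φ : Type*}
    (Ω : Set (Θ × Φ))
    (f : Θ → ((i : ι) → V i) → ℝ)
    (g : Φ → (ι → Bool) → ((i : ι) → V i) → ℝ)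
    (hf : ∀ θ y, 0 ≤ f θ y)
    (hg : ∀ φ m y, 0 ≤ g φ m y)
    (mr : ι → Bool) (yr : (i : ι) → V i)
    (hrect : Ω = {θ : Θ | ∃ φ, (θ, φ) ∈ Ω} ×ˢ {φ : Φ | ∃ θ, (θ, φ) ∈ Ω})
    (hMAR : ∀ φ ∈ {φ : Φ | ∃ θ, (θ, φ) ∈ Ω}, ∀ y : (i : ι) → V i,
      (∀ i, mr i = true → y i = yr i) → g φ mr y = g φ mr yr)
    (θh : Θ) (φh : Φ) (hmem : (θh, φh) ∈ Ω)
    (hmax : ∀ x ∈ Ω,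
      (∑ y ∈ Finset.univ.filter (fun y : (i : ι) → V i => ∀ i, mr i = true → y i = yr i), f x.1 y * g x.2 mr y)
      ≤ ∑ y ∈ Finset.univ.filter (fun y : (i : ι) → V i => ∀ i, mr i = true → y i = yr i), f θh y * g φh mr y)
    (hgpos : 0 < g φh mr yr) :
    ∀ θ ∈ {θ : Θ | ∃ φ, (θ, φ) ∈ Ω},
      (∑ y ∈ Finset.univ.filter (fun y : (i : ι) → V i => ∀ i, mr i = true → y i = yr i), f θ y)
      ≤ ∑ y ∈ Finset.univ.filter (fun y : (i : ι) → V i => ∀ i, mr i = true → y i = yr i), f θh y := by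
  intro θ hθ
  have hφ : φh ∈ {φ : Φ | ∃ θ, (θ, φ) ∈ Ω} := ⟨θh, hmem⟩
  have hθφ : (θ, φh) ∈ Ω := by
    rw [hrect]
    exact ⟨hθ, hφ⟩
  have factor : ∀ t : Θ,
      ∑ y ∈ Finset.univ.filter (fun y : (i : ι) → V i => ∀ i, mr i = true → y i = yr i),
        f t y * g φh mr y =
      (∑ y ∈ Finset.univ.filter (fun y : (i : ι) → V i => ∀ i, mr i = true → y i = yr i),
        f t y) * g φh mr yr := by
    intro t
    rw [Finset.sum_mul]
    refine Finset.sum_congr rfl fun y hy => ?_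
    rw [hMAR φh hφ y (Finset.mem_filter.mp hy).2]
  have hle := hmax (θ, φh) hθφ
  rw [factor, factor] at hle
  exact le_of_mul_le_mul_right hle hgpos
end

section
/- Realised MCAR is equivalent to realised MAR together with observed at random (Section 3 claim, attributed to Heitjan and Little): the data are realised MCAR (for every φ ∈ Ω_φ and all y, y', g φ m̃ y = g φ m̃ y') if and only if both of the following hold: (a) the data are realised MAR (for every φ ∈ Ω_φ and every y with o(y,m̃)=o(ỹ,m̃), g φ m̃ y = g φ m̃ ỹ), and (b) the observed data are observed at random (for every φ ∈ Ω_φ and all y, y' satisfying y i = y' i for every i with m̃ i = false, g φ m̃ y = g φ m̃ y'). -/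
/-- Realised MCAR is equivalent to realised MAR together with the observed data
being observed at random. -/
theorem realisedMCAR_iff_realisedMAR_and_OAR
    {ι : Type*} [Fintype ι] [DecidableEq ι]
    {V : ι → Type*} [∀ i, Fintype (V i)] [∀ i, DecidableEq (V i)]
    {Φ : Type*} (Ωφ : Set Φ)
    (g : Φ → (ι → Bool) → ((i : ι) → V i) → ℝ)
    (hg : ∀ φ m y, 0 ≤ g φ m y)
    (mr : ι → Bool) (yr : (i : ι) → V i) :
    -- realised MCAR
    (∀ φ ∈ Ωφ, ∀ y y' : (i : ι) → V i, g φ mr y = g φ mr y')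
    ↔
    -- (a) realised MAR
    ((∀ φ ∈ Ωφ, ∀ y : (i : ι) → V i,
        (∀ i, mr i = true → y i = yr i) → g φ mr y = g φ mr yr)
      ∧
      -- (b) observed at random
      (∀ φ ∈ Ωφ, ∀ y y' : (i : ι) → V i,
        (∀ i, mr i = false → y i = y' i) → g φ mr y = g φ mr y')) := by
  refine ⟨fun h => ⟨fun φ hφ y _ => h φ hφ y yr, fun φ hφ y y' _ => h φ hφ y y'⟩, ?_⟩
  rintro ⟨hMAR, hOAR⟩ φ hφ
  have eq_realised (y : (i : ι) → V i) : g φ mr y = g φ mr yr := by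
    -- splice the realised observed part with the missing part of `y`
    let z : (i : ι) → V i := fun i => if mr i = true then yr i else y i
    calc g φ mr y = g φ mr z := hOAR φ hφ y z fun i hi => by simp [z, hi]
      _ = g φ mr yr := hMAR φ hφ z fun i hi => by simp [z, hi]
  exact fun y y' => (eq_realised y).trans (eq_realised y').symm
end

section
/- Bayesian posterior equality in repeated samples under everywhere MAR (Section 5.4 claim): Suppose Θ and Φ are finite types, the data are everywhere MAR (with Ω_φ = Φ), and the prior p : Θ × Φ → ℝ factorises as p(θ,φ) = p_θ(θ) · p_φ(φ) with p_θ, p_φ nonnegative. Then for EVERY possible missingness pattern m and complete-data value y₀: writing L₁^{m,y₀}(θ,φ) = ∑_{y : o(y,m)=o(y₀,m)} f θ y · g φ m y and L₂^{m,y₀}(θ) = ∑_{y : o(y,m)=o(y₀,m)} f θ y, if Z = ∑_{(θ,φ)} p(θ,φ) · L₁^{m,y₀}(θ,φ) > 0, then Z₂ = ∑_θ p_θ(θ) · L₂^{m,y₀}(θ) > 0 and for every θ, (∑_φ p(θ,φ) · L₁^{m,y₀}(θ,φ)) / Z = p_θ(θ) · L₂^{m,y₀}(θ) / Z₂; that is,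 the posterior distribution of θ from the joint model equals that from the model ignoring the missingness pattern for every possible realisation (y₀, m). -/
/-- Bayesian posterior equality in repeated samples under everywhere MAR: for
every possible missingness pattern `m` and complete-data value `y₀`, the
posterior distribution of `θ` from the joint model equals that from the model
ignoring the missingness pattern. -/
theorem bayesian_posterior_eq_everywhere_of_everywhereMAR
    {ι : Type*} [Fintype ι] [DecidableEq ι]
    {V : ι → Type*} [∀ i, Fintype (V i)] [∀ i, DecidableEq (V i)]
    {Θ Φ : Type*} [Fintype Θ] [Fintype Φ]
    (f : Θ → ((i : ι) → V i) → ℝ)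
    (g : Φ → (ι → Bool) → ((i : ι) → V i) → ℝ)
    (hf : ∀ θ y, 0 ≤ f θ y)
    (hg : ∀ φ m y, 0 ≤ g φ m y)
    -- everywhere MAR (with Ω_φ = Φ)
    (hMAR : ∀ φ : Φ, ∀ m : ι → Bool, ∀ y y' : (i : ι) → V i,
      (∀ i, m i = true → y i = y' i) → g φ m y = g φ m y')
    (p : Θ × Φ → ℝ) (pθ : Θ → ℝ) (pφ : Φ → ℝ)
    (hpθ : ∀ θ, 0 ≤ pθ θ) (hpφ : ∀ φ, 0 ≤ pφ φ)
    (hfact : ∀ θ φ, p (θ, φ) = pθ θ * pφ φ) :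
    ∀ (m : ι → Bool) (y₀ : (i : ι) → V i),
      0 < (∑ x : Θ × Φ, p x *
          ∑ y ∈ Finset.univ.filter
            (fun y : (i : ι) → V i => ∀ i, m i = true → y i = y₀ i),
            f x.1 y * g x.2 m y) →
      0 < (∑ θ : Θ, pθ θ *
          ∑ y ∈ Finset.univ.filter
            (fun y : (i : ι) → V i => ∀ i, m i = true → y i = y₀ i),
            f θ y) ∧
      ∀ θ : Θ,
        (∑ φ : Φ, p (θ, φ) *
            ∑ y ∈ Finset.univ.filter
              (fun y : (i : ι) → V i => ∀ i, m i = true → y i = y₀ i),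
              f θ y * g φ m y) /
          (∑ x : Θ × Φ, p x *
            ∑ y ∈ Finset.univ.filter
              (fun y : (i : ι) → V i => ∀ i, m i = true → y i = y₀ i),
              f x.1 y * g x.2 m y)
        = pθ θ * (∑ y ∈ Finset.univ.filter
              (fun y : (i : ι) → V i => ∀ i, m i = true → y i = y₀ i),
              f θ y) /
            (∑ θ' : Θ, pθ θ' *
              ∑ y ∈ Finset.univ.filter
                (fun y : (i : ι) → V i => ∀ i, m i = true → y i = y₀ i),
                f θ' y) := by
  intro m y₀ hZ
  have hL : ∀ θ φ, ∑ y ∈ Finset.univ.filter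
        (fun y : (i : ι) → V i => ∀ i, m i = true → y i = y₀ i), f θ y * g φ m y
      = (∑ y ∈ Finset.univ.filter
        (fun y : (i : ι) → V i => ∀ i, m i = true → y i = y₀ i), f θ y) * g φ m y₀ := by
    intro θ φ
    rw [Finset.sum_mul]
    refine Finset.sum_congr rfl fun y hy => ?_
    rw [hMAR φ m y y₀ (Finset.mem_filter.mp hy).2]
  simp only [Fintype.sum_prod_type, hL, hfact] at hZ ⊢
  obtain ⟨L, hL₂⟩ : ∃ L : Θ → ℝ, ∀ θ, ∑ y ∈ Finset.univ.filter
      (fun y : (i : ι) → V i => ∀ i, m i = true → y i = y₀ i), f θ y = L θ :=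
    ⟨_, fun _ => rfl⟩
  simp only [hL₂] at hZ ⊢
  have hmarg : ∀ θ, ∑ φ, pθ θ * pφ φ * (L θ * g φ m y₀)
      = pθ θ * L θ * ∑ φ, pφ φ * g φ m y₀ := by
    intro θ
    rw [Finset.mul_sum]
    exact Finset.sum_congr rfl fun φ _ => by ring
  simp only [hmarg, ← Finset.sum_mul] at hZ ⊢
  have hC : 0 ≤ ∑ φ, pφ φ * g φ m y₀ :=
    Finset.sum_nonneg fun φ _ => mul_nonneg (hpφ φ) (hg φ m y₀)
  exact ⟨pos_of_mul_pos_left hZ hC, fun θ =>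
    mul_div_mul_right _ _ (right_ne_zero_of_mul hZ.ne')⟩
end
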